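/- For all integers n ≥ 1 and k ≥ 0, B_{n,k} = (−1)^n · Σ_{ℓ=1}^{n} Σ_{m=1}^{n} m! · S(n,m) · S(m,ℓ) · (−1)^ℓ · ĉ_{ℓ,k}. -/

import Mathlib

/-- Unsigned Stirling numbers of the first kind:
`c(0,0)=1`, `c(n,m)=0` for `m>n` or (`n>0` and `m=0`), and `c(n+1,m)=n*c(n,m)+c(n,m-1)`. -/
def stirling1 : ℕ → ℕ → ℕ
  | 0, 0 => 1
  | 0, _ + 1 => 0
  | _ + 1, 0 => 0
  | n + 1, m + 1 => n * stirling1 n (m + 1) + stirling1 n m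

/-- Stirling numbers of the second kind:
`S(0,0)=1`, `S(n,m)=0` for `m>n` or (`n>0` and `m=0`), and `S(n+1,m)=m*S(n,m)+S(n,m-1)`. -/
def stirling2 : ℕ → ℕ → ℕ
  | 0, 0 => 1
  | 0, _ + 1 => 0
  | _ + 1, 0 => 0
  | n + 1, m + 1 => (m + 1) * stirling2 n (m + 1) + stirling2 n m

/-- Poly-Cauchy numbers of the second kind (negated upper index, unsigned):
`ĉ_{n,k} = Σ_{m=0}^n c(n,m)·(m+1)^k`. -/
def polyCauchy (n k : ℕ) : ℕ := ∑ m ∈ Finset.range (n + 1), stirling1 n m * (m + 1) ^ k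

/-- Poly-Bernoulli numbers with negative upper index:
`B_{n,k} = Σ_{m=0}^n (−1)^{n+m}·m!·S(n,m)·(m+1)^k`. -/
def polyBernoulli (n k : ℕ) : ℤ :=
  ∑ m ∈ Finset.range (n + 1),
    (-1) ^ (n + m) * (Nat.factorial m : ℤ) * stirling2 n m * (m + 1) ^ k

theorem stirling1_eq_zero_of_lt : ∀ {n m : ℕ}, n < m → stirling1 n m = 0
  | 0, _ + 1, _ => by simp [stirling1]
  | n + 1, m + 1, h => by
    rw [stirling1, stirling1_eq_zero_of_lt (by omega : n < m + 1),
      stirling1_eq_zero_of_lt (by omega : n < m), mul_zero]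

theorem stirling2_eq_zero_of_lt : ∀ {n m : ℕ}, n < m → stirling2 n m = 0
  | 0, _ + 1, _ => by simp [stirling2]
  | n + 1, m + 1, h => by
    rw [stirling2, stirling2_eq_zero_of_lt (by omega : n < m + 1),
      stirling2_eq_zero_of_lt (by omega : n < m), mul_zero]

theorem stirling2_zero_right {n : ℕ} (hn : 1 ≤ n) : stirling2 n 0 = 0 := by
  obtain ⟨n, rfl⟩ := Nat.exists_eq_add_of_le' hn
  rw [stirling2]

theorem mul_stirling1_zero_right (n : ℕ) : n * stirling1 n 0 = 0 := by
  cases n <;> simp [stirling1]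

theorem sum_stirling1_succ (n : ℕ) (f : ℕ → ℤ) :
    ∑ j ∈ Finset.range (n + 2), (stirling1 (n + 1) j : ℤ) * f j =
      n * ∑ j ∈ Finset.range (n + 1), (stirling1 n j : ℤ) * f j +
        ∑ j ∈ Finset.range (n + 1), (stirling1 n j : ℤ) * f (j + 1) := by
  have hext : ∑ j ∈ Finset.range (n + 1), (stirling1 n j : ℤ) * f j =
      ∑ j ∈ Finset.range (n + 2), (stirling1 n j : ℤ) * f j := by
    rw [Finset.sum_range_succ _ (n + 1), stirling1_eq_zero_of_lt (Nat.lt_succ_self n)]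
    simp
  have hzero : (n : ℤ) * stirling1 n 0 = 0 := mod_cast mul_stirling1_zero_right n
  rw [hext, Finset.sum_range_succ', Finset.sum_range_succ' _ (n + 1), mul_add, ← mul_assoc,
    hzero, Finset.mul_sum]
  simp only [stirling1, Nat.cast_zero, zero_mul, add_zero]
  rw [← Finset.sum_add_distrib]
  refine Finset.sum_congr rfl fun j _ => ?_
  push_cast
  ring

theorem sum_stirling2_succ (n : ℕ) (g : ℕ → ℤ) :
    ∑ l ∈ Finset.range (n + 2), (stirling2 (n + 1) l : ℤ) * g l =
      ∑ l ∈ Finset.range (n + 1), (stirling2 n l : ℤ) * (l * g l + g (l + 1)) := by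
  have hext : ∑ l ∈ Finset.range (n + 1), (stirling2 n l : ℤ) * (l * g l) =
      ∑ l ∈ Finset.range (n + 2), (stirling2 n l : ℤ) * (l * g l) := by
    rw [Finset.sum_range_succ _ (n + 1), stirling2_eq_zero_of_lt (Nat.lt_succ_self n)]
    simp
  simp only [mul_add (stirling2 n _ : ℤ)]
  rw [Finset.sum_add_distrib, hext, Finset.sum_range_succ', Finset.sum_range_succ' _ (n + 1)]
  simp only [stirling2, Nat.cast_zero, zero_mul, mul_zero, add_zero]
  rw [← Finset.sum_add_distrib]
  refine Finset.sum_congr rfl fun l _ => ?_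
  push_cast
  ring

/-- Stirling inversion: the alternating transform by Stirling numbers of the second kind undoes
the transform by unsigned Stirling numbers of the first kind, up to sign. -/
theorem sum_stirling2_mul_sum_stirling1 (m : ℕ) (f : ℕ → ℤ) :
    ∑ l ∈ Finset.range (m + 1), (stirling2 m l : ℤ) *
      ((-1) ^ l * ∑ j ∈ Finset.range (l + 1), (stirling1 l j : ℤ) * f j) = (-1) ^ m * f m := by
  induction m generalizing f with
  | zero => simp [stirling1, stirling2]
  | succ m ih =>
    rw [sum_stirling2_succ, pow_succ, mul_neg_one, neg_mul, ← ih fun j => f (j + 1),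
      ← Finset.sum_neg_distrib]
    refine Finset.sum_congr rfl fun l _ => ?_
    rw [sum_stirling1_succ]
    ring

theorem sum_Icc_one_eq_sum_range {N : ℕ} {g : ℕ → ℤ} (h0 : g 0 = 0) :
    ∑ l ∈ Finset.Icc 1 N, g l = ∑ l ∈ Finset.range (N + 1), g l := by
  refine Finset.sum_subset (fun l hl => ?_) fun l hl hl' => ?_
  · simp only [Finset.mem_Icc, Finset.mem_range] at *
    omega
  · simp only [Finset.mem_Icc, Finset.mem_range] at *
    obtain rfl : l = 0 := by omega
    exact h0

theorem sum_stirling2_mul_polyCauchy {m n : ℕ} (k : ℕ) (hm : 1 ≤ m) (hmn : m ≤ n) :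
    ∑ l ∈ Finset.Icc 1 n, (stirling2 m l : ℤ) * ((-1) ^ l * polyCauchy l k) =
      (-1) ^ m * (m + 1) ^ k := by
  rw [sum_Icc_one_eq_sum_range (by simp [stirling2_zero_right hm]),
    ← sum_stirling2_mul_sum_stirling1 m fun j => ((j : ℤ) + 1) ^ k]
  symm
  refine (Finset.sum_congr rfl fun l _ => ?_).trans
    (Finset.sum_subset (Finset.range_mono (by omega)) fun l _ hl => ?_)
  · simp [polyCauchy]
  · rw [stirling2_eq_zero_of_lt (by simpa using hl)]
    simp

theorem polyBernoulli_eq_sum_polyCauchy (n k : ℕ) (hn : 1 ≤ n) :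
    polyBernoulli n k = (-1) ^ n * ∑ ℓ ∈ Finset.Icc 1 n, ∑ m ∈ Finset.Icc 1 n,
      (Nat.factorial m : ℤ) * stirling2 n m * stirling2 m ℓ * (-1) ^ ℓ * polyCauchy ℓ k := by
  rw [polyBernoulli, ← sum_Icc_one_eq_sum_range (by simp [stirling2_zero_right hn]),
    Finset.sum_comm, Finset.mul_sum]
  refine Finset.sum_congr rfl fun m hm => ?_
  obtain ⟨hm, hmn⟩ := Finset.mem_Icc.mp hm
  simp only [mul_assoc]
  rw [← Finset.mul_sum, ← Finset.mul_sum, sum_stirling2_mul_polyCauchy k hm hmn]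
  ring
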